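/- Let σ : K → K be the ring homomorphism with σ(q) = q⁻¹ and let bar : K[x] → K[x] be the induced ring homomorphism with bar(c) = σ(c) for c ∈ K and bar(x) = −q·x. Then for all i, j ∈ ℕ the following identity holds in K[x]: bar(B_q(i))·bar(B_q(j)) = Σ_{k=max(i,j)}^{i+j} (q^{i(i−k)+j(j−k)}·[k]_q! / ([k−i]_q!·[k−j]_q!·[i+j−k]_q!)) · bar(B_q(k)). In particular these structure constants are polynomials in q⁻¹ with natural number coefficients. -/

import Mathlib

open Polynomial

noncomputable section

/-- `K = ℚ(q)`, the field of rational functions in `q` over `ℚ`. -/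
abbrev K : Type := RatFunc ℚ

/-- The variable `q ∈ K`. -/
def qq : K := RatFunc.X

/-- The quantum integer `[n]_q = (q^n - 1)/(q - 1) ∈ K`. -/
def qInt (n : ℤ) : K := (qq ^ n - 1) / (qq - 1)

/-- The quantum factorial `[n]_q! = ∏_{i=1}^n [i]_q`. -/
def qFact (n : ℕ) : K := ∏ i ∈ Finset.range n, qInt ((i : ℤ) + 1)

/-- The `q`-binomial coefficient polynomial `B_q(k) ∈ K[x]`, with `B_q(0) = 1`. -/
def Bq (k : ℕ) : K[X] :=
  C ((qq ^ (k.choose 2) * qFact k)⁻¹) * ∏ i ∈ Finset.range k, (X - C (qInt i))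

/-- The bar involution on `K[x]` induced by `σ : K → K` with `σ(q) = q⁻¹`: it applies `σ`
to coefficients and sends `x ↦ −q·x`. -/
def barMap (σ : K →+* K) : K[X] →+* K[X] :=
  eval₂RingHom (Polynomial.C.comp σ) (-(C qq * X))

lemma qq_ne : qq ≠ 0 := RatFunc.X_ne_zero

lemma qq_pow_ne (n : ℕ) : qq ^ (n + 1) ≠ 1 := by
  intro h
  have h2 : (algebraMap ℚ[X] (RatFunc ℚ)) (X ^ (n + 1)) = algebraMap ℚ[X] (RatFunc ℚ) 1 := by
    rw [map_pow, map_one, RatFunc.algebraMap_X]; exact h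
  have h3 := RatFunc.algebraMap_injective ℚ h2
  have h4 := congrArg natDegree h3
  simp at h4

lemma qq_sub_ne : qq - 1 ≠ 0 := by
  have := qq_pow_ne 0
  rw [zero_add, pow_one] at this
  exact sub_ne_zero.mpr this

lemma qInt_succ_ne (n : ℕ) : qInt ((n : ℤ) + 1) ≠ 0 := by
  unfold qInt
  refine div_ne_zero (sub_ne_zero.mpr ?_) qq_sub_ne
  have := qq_pow_ne n
  exact_mod_cast this

lemma qFact_ne (n : ℕ) : qFact n ≠ 0 :=
  Finset.prod_ne_zero_iff.mpr fun i _ => qInt_succ_ne i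

lemma qFact_succ (n : ℕ) : qFact (n + 1) = qFact n * qInt ((n : ℤ) + 1) :=
  Finset.prod_range_succ _ _

lemma qInt_add (m n : ℤ) : qInt (m + n) = qInt m + qq ^ m * qInt n := by
  unfold qInt
  have := qq_sub_ne
  rw [zpow_add₀ qq_ne]
  field_simp
  ring

lemma qInt_zero : qInt 0 = 0 := by simp [qInt]

/-- Gaussian binomials as polynomials with natural coefficients. -/
def gaussP : ℕ → ℕ → Polynomial ℕ
  | _, 0 => 1
  | 0, _ + 1 => 0
  | n + 1, k + 1 => gaussP n k + X ^ (k + 1) * gaussP n (k + 1)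

/-- Gaussian binomials evaluated at `q`. -/
def gau (n k : ℕ) : K := (gaussP n k).eval₂ (Nat.castRingHom K) qq

lemma gau_zero (n : ℕ) : gau n 0 = 1 := by simp [gau, gaussP]
lemma gau_zero_succ (k : ℕ) : gau 0 (k + 1) = 0 := by simp [gau, gaussP]
lemma gau_succ (n k : ℕ) : gau (n + 1) (k + 1) = gau n k + qq ^ (k + 1) * gau n (k + 1) := by
  simp [gau, gaussP, eval₂_add, eval₂_mul]

lemma gau_lt (n k : ℕ) (h : n < k) : gau n k = 0 := by
  induction n generalizing k with
  | zero => obtain ⟨k, rfl⟩ : ∃ k', k = k' + 1 := ⟨k - 1, by omega⟩; exact gau_zero_succ k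
  | succ n ih =>
    obtain ⟨k, rfl⟩ : ∃ k', k = k' + 1 := ⟨k - 1, by omega⟩
    rw [gau_succ, ih k (by omega), ih (k + 1) (by omega)]; simp

lemma factB_of (n k : ℕ)
    (hA : qInt ((k : ℤ) + 1) * gau n (k + 1) = qInt ((n : ℤ) - k) * gau n k) :
    qInt ((k : ℤ) + 1) * gau (n + 1) (k + 1) = qInt ((n : ℤ) + 1) * gau n k := by
  have h := qInt_add ((k : ℤ) + 1) ((n : ℤ) - k)
  rw [show (k : ℤ) + 1 + ((n : ℤ) - k) = n + 1 by ring] at h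
  have e : qq ^ ((k : ℤ) + 1) = qq ^ (k + 1) := by exact_mod_cast rfl
  rw [e] at h
  rw [gau_succ, h]
  linear_combination qq ^ (k + 1) * hA

lemma factC_of (n k : ℕ)
    (hA : ∀ k : ℕ, qInt ((k : ℤ) + 1) * gau n (k + 1) = qInt ((n : ℤ) - k) * gau n k) :
    qInt ((n : ℤ) + 1 - k) * gau (n + 1) k = qInt ((n : ℤ) + 1) * gau n k := by
  cases k with
  | zero => simp [gau_zero]
  | succ k =>
    have h := qInt_add ((k : ℤ) + 1) ((n : ℤ) - k)
    rw [show (k : ℤ) + 1 + ((n : ℤ) - k) = n + 1 by ring] at h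
    have e : qq ^ ((k : ℤ) + 1) = qq ^ (k + 1) := by exact_mod_cast rfl
    rw [e] at h
    have e2 : (n : ℤ) + 1 - ((k + 1 : ℕ) : ℤ) = n - k := by push_cast; ring
    rw [e2, gau_succ, h]
    linear_combination - hA k

lemma factA (n k : ℕ) :
    qInt ((k : ℤ) + 1) * gau n (k + 1) = qInt ((n : ℤ) - k) * gau n k := by
  induction n generalizing k with
  | zero =>
    cases k with
    | zero => simp [gau_zero_succ, qInt_zero]
    | succ k => simp [gau_zero_succ]
  | succ n ih =>
    rw [factB_of n k (ih k)]
    push_cast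
    rw [factC_of n k ih]

lemma factB (n k : ℕ) :
    qInt ((k : ℤ) + 1) * gau (n + 1) (k + 1) = qInt ((n : ℤ) + 1) * gau n k :=
  factB_of n k (factA n k)

lemma factC (n k : ℕ) :
    qInt ((n : ℤ) + 1 - k) * gau (n + 1) k = qInt ((n : ℤ) + 1) * gau n k :=
  factC_of n k (factA n)

lemma gau_fact (a b : ℕ) : gau (a + b) a * (qFact a * qFact b) = qFact (a + b) := by
  induction a with
  | zero => simp [gau_zero, qFact]
  | succ a ih =>
    have h := factB (a + b) a
    rw [show a + 1 + b = a + b + 1 by ring, qFact_succ, qFact_succ, ← ih]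
    linear_combination qFact a * qFact b * h

/-- Structure constants of the unbarred basis, indexed by `a = k - i`. -/
def DD (i j a : ℕ) : K := qq ^ ((a : ℤ) * ((i : ℤ) + a - j)) * (gau (i + a) j * gau j a)

lemma DD_rec_zero (i j : ℕ) :
    qq ^ j * qInt ((j : ℤ) + 1) * DD i (j + 1) 0 = qq ^ j * qInt ((i : ℤ) - j) * DD i j 0 := by
  have := factA i j
  simp only [DD, gau_zero, Nat.cast_zero, zero_mul, zpow_zero, add_zero]
  linear_combination qq ^ j * this

lemma DD_rec (i j a : ℕ) :
    qq ^ j * qInt ((j : ℤ) + 1) * DD i (j + 1) (a + 1) =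
      qq ^ (i + a) * qInt ((i : ℤ) + a + 1) * DD i j a +
        qq ^ j * qInt ((i : ℤ) + a + 1 - j) * DD i j (a + 1) := by
  have hA := factA (i + a + 1) j
  have hC := factC (i + a) j
  push_cast at hA hC
  simp only [DD, ← add_assoc]
  push_cast
  rw [gau_succ j a]
  have e1 : qq ^ (((a : ℤ) + 1) * ((i : ℤ) + (a + 1) - (j + 1))) * qq ^ j
      = qq ^ (((a : ℤ)) * ((i : ℤ) + a - j)) * qq ^ (i + a) := by
    rw [← zpow_natCast, ← zpow_natCast, ← zpow_add₀ qq_ne, ← zpow_add₀ qq_ne]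
    congr 1; push_cast; ring
  have e2 : qq ^ (((a : ℤ) + 1) * ((i : ℤ) + (a + 1) - j))
      = qq ^ (((a : ℤ) + 1) * ((i : ℤ) + (a + 1) - (j + 1))) * qq ^ (a + 1) := by
    rw [← zpow_natCast, ← zpow_add₀ qq_ne]
    congr 1; push_cast; ring
  simp only [← add_assoc] at e1 e2 ⊢
  rw [e2]
  generalize qq ^ (((a : ℤ) + 1) * ((i : ℤ) + a + 1 - (j + 1))) = z at *
  generalize qq ^ (((a : ℤ)) * ((i : ℤ) + a - j)) = y at *
  linear_combination (z * qq ^ j * (gau j a + qq ^ (a + 1) * gau j (a + 1))) * hA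
    + (qInt ((i : ℤ) + a + 1 - j) * gau (i + a + 1) j * gau j a) * e1
    + (y * qq ^ (i + a) * gau j a) * hC

lemma Bq_succ (k : ℕ) :
    C (qq ^ k * qInt ((k : ℤ) + 1)) * Bq (k + 1) = (X - C (qInt k)) * Bq k := by
  unfold Bq
  rw [Finset.prod_range_succ, qFact_succ, Nat.choose_succ_succ' k 1, Nat.choose_one_right]
  have h1 := qq_ne
  have h2 := qFact_ne k
  have h3 := qInt_succ_ne k
  have : qq ^ k * qInt ((k : ℤ) + 1) *
      (qq ^ (k + k.choose (1 + 1)) * (qFact k * qInt ((k : ℤ) + 1)))⁻¹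
      = (qq ^ (k.choose 2) * qFact k)⁻¹ := by
    rw [pow_add]; field_simp
  rw [← this, C_mul (a := qq ^ k * qInt ((k : ℤ) + 1))]
  ring

lemma Bq_shift (j k : ℕ) :
    (X - C (qInt j)) * Bq k = C (qq ^ k * qInt ((k : ℤ) + 1)) * Bq (k + 1)
      + C (qq ^ j * qInt ((k : ℤ) - j)) * Bq k := by
  have h := qInt_add j ((k : ℤ) - j)
  rw [show (j : ℤ) + (k - j) = k by ring, zpow_natCast] at h
  have h2 : C (qInt k) = C (qInt j) + C (qq ^ j * qInt ((k : ℤ) - j)) := by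
    rw [← C_add, h]
  rw [Bq_succ, h2]
  ring

lemma DD_gt (i j a : ℕ) (h : j < a) : DD i j a = 0 := by
  simp [DD, gau_lt j a h]

lemma Bq_mul (i j : ℕ) :
    Bq i * Bq j = ∑ a ∈ Finset.range (j + 1), C (DD i j a) * Bq (i + a) := by
  induction j with
  | zero => simp [DD, gau_zero, Bq, qFact]
  | succ j ih =>
    have hne : C (qq ^ j * qInt ((j : ℤ) + 1)) ≠ 0 :=
      C_ne_zero.mpr (mul_ne_zero (pow_ne_zero _ qq_ne) (qInt_succ_ne j))
    apply mul_left_cancel₀ hne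
    have e : C (qq ^ j * qInt ((j : ℤ) + 1)) * (Bq i * Bq (j + 1))
        = (X - C (qInt j)) * (Bq i * Bq j) := by
      linear_combination Bq i * Bq_succ j
    rw [e, ih, Finset.mul_sum, Finset.mul_sum, Finset.sum_range_succ' _ (j + 1)]
    have t : ∀ a, (X - C (qInt j)) * (C (DD i j a) * Bq (i + a)) =
        C (qq ^ (i + a) * qInt ((i : ℤ) + a + 1) * DD i j a) * Bq (i + (a + 1))
        + C (qq ^ j * qInt ((i : ℤ) + a - j) * DD i j a) * Bq (i + a) := by
      intro a
      have := Bq_shift j (i + a)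
      push_cast at this
      rw [C_mul (b := DD i j a), C_mul (b := DD i j a), ← add_assoc i a 1]
      linear_combination C (DD i j a) * this
    have s : ∀ a, C (qq ^ j * qInt ((j : ℤ) + 1)) * (C (DD i (j + 1) (a + 1)) * Bq (i + (a + 1)))
        = C (qq ^ (i + a) * qInt ((i : ℤ) + a + 1) * DD i j a) * Bq (i + (a + 1))
        + C (qq ^ j * qInt ((i : ℤ) + (a + 1 : ℕ) - j) * DD i j (a + 1)) * Bq (i + (a + 1)) := by
      intro a
      rw [← mul_assoc, ← C_mul, DD_rec, C_add, add_mul]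
      push_cast
      rw [← add_assoc (i : ℤ)]
    rw [Finset.sum_congr rfl fun a _ => t a, Finset.sum_congr rfl fun a _ => s a,
      Finset.sum_add_distrib, Finset.sum_add_distrib, add_assoc]
    congr 1
    rw [← mul_assoc, ← C_mul, DD_rec_zero]
    have := Finset.sum_range_succ'
      (fun a => C (qq ^ j * qInt ((i : ℤ) + a - j) * DD i j a) * Bq (i + a)) (j + 1)
    rw [Finset.sum_range_succ, DD_gt i j (j + 1) (by omega)] at this
    simpa using this

lemma choose_two_add (a b : ℕ) :
    (a + b).choose 2 = a.choose 2 + b.choose 2 + a * b := by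
  induction b with
  | zero => simp
  | succ b ih =>
    rw [← add_assoc, Nat.choose_succ_succ' (a + b) 1, Nat.choose_succ_succ' b 1]
    simp only [Nat.choose_one_right, Nat.reduceAdd]
    rw [ih]; ring

lemma sigma_qInt (σ : K →+* K) (hσ : σ qq = qq⁻¹) (n : ℕ) :
    σ (qInt ((n : ℤ) + 1)) * qq ^ n = qInt ((n : ℤ) + 1) := by
  have h0 := qq_ne
  have h1 := qq_sub_ne
  have e : qq ^ ((n : ℤ) + 1) = qq ^ (n + 1) := by exact_mod_cast rfl
  unfold qInt
  rw [e, map_div₀, map_sub, map_sub, map_pow, hσ, map_one]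
  have h2 : qq⁻¹ - 1 ≠ 0 := by
    intro h
    apply h1
    have : qq * (qq⁻¹ - 1) = 0 := by rw [h, mul_zero]
    rw [mul_sub, mul_inv_cancel₀ h0] at this
    linear_combination -this
  rw [div_mul_eq_mul_div, div_eq_div_iff h2 h1, inv_pow]
  field_simp
  ring

lemma sigma_qFact (σ : K →+* K) (hσ : σ qq = qq⁻¹) (n : ℕ) :
    σ (qFact n) = qFact n * (qq ^ (n.choose 2))⁻¹ := by
  rw [eq_mul_inv_iff_mul_eq₀ (pow_ne_zero _ qq_ne)]
  induction n with
  | zero => simp [qFact]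
  | succ n ih =>
    rw [qFact_succ, map_mul, Nat.choose_succ_succ' n 1, Nat.choose_one_right, pow_add]
    have := sigma_qInt σ hσ n
    linear_combination σ (qInt ((n : ℤ) + 1)) * qq ^ n * ih + qFact n * this

lemma DD_eq (a b c : ℕ) :
    DD (b + c) (a + c) a
      = qq ^ (a * b) * qFact (a + b + c) / (qFact a * qFact b * qFact c) := by
  have h1 := gau_fact (a + c) b
  have h2 := gau_fact a c
  have ha := qFact_ne a
  have hb := qFact_ne b
  have hc := qFact_ne c
  unfold DD
  rw [eq_div_iff (by simp [ha, hb, hc])]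
  have e : qq ^ ((a : ℤ) * (((b + c : ℕ) : ℤ) + a - ((a + c : ℕ) : ℤ))) = qq ^ (a * b) := by
    rw [← zpow_natCast]; congr 1; push_cast; ring
  rw [e, show b + c + a = a + c + b by ring, show a + b + c = a + c + b by ring, ← h1, ← h2]
  ring

lemma sigma_DD (σ : K →+* K) (hσ : σ qq = qq⁻¹) (a b c : ℕ) :
    σ (DD (b + c) (a + c) a) =
      qq ^ (-(((b + c) * a + (a + c) * b : ℕ) : ℤ)) * qFact (a + b + c) /
        (qFact a * qFact b * qFact c) := by
  have ha := qFact_ne a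
  have hb := qFact_ne b
  have hc := qFact_ne c
  have h0 := qq_ne
  rw [DD_eq, map_div₀, map_mul, map_mul, map_mul, map_pow, hσ, sigma_qFact σ hσ,
    sigma_qFact σ hσ, sigma_qFact σ hσ, sigma_qFact σ hσ, choose_two_add, choose_two_add,
    zpow_neg, zpow_natCast, inv_pow]
  simp only [pow_add, add_mul, mul_comm c a, mul_comm c b, mul_comm b a]
  field_simp

lemma sigma_coeff (σ : K →+* K) (hσ : σ qq = qq⁻¹) (i j k : ℕ)
    (hk : k ∈ Finset.Icc (max i j) (i + j)) :
    qq ^ ((i : ℤ) * ((i : ℤ) - (k : ℤ)) + (j : ℤ) * ((j : ℤ) - (k : ℤ))) * qFact k /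
          (qFact (k - i) * qFact (k - j) * qFact (i + j - k)) = σ (DD i j (k - i)) := by
  rw [Finset.mem_Icc] at hk
  obtain ⟨a, b, c, rfl, rfl, rfl⟩ : ∃ a b c, i = b + c ∧ j = a + c ∧ k = a + b + c :=
    ⟨k - i, k - j, i + j - k, by omega, by omega, by omega⟩
  rw [show a + b + c - (b + c) = a by omega, show a + b + c - (a + c) = b by omega,
    show b + c + (a + c) - (a + b + c) = c by omega, sigma_DD σ hσ]
  congr 3
  push_cast; ring

lemma barMap_C (σ : K →+* K) (c : K) : barMap σ (C c) = C (σ c) := by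
  simp [barMap]

/-- Structure constants for the barred basis:
`bar(B_q(i))·bar(B_q(j)) = Σ_{k=max(i,j)}^{i+j}
  q^{i(i−k)+j(j−k)}·[k]_q!/([k−i]_q![k−j]_q![i+j−k]_q!) · bar(B_q(k))`,
and these coefficients are polynomials in `q⁻¹` with natural number coefficients. -/
theorem bar_qbinomial_mul (σ : K →+* K) (hσ : σ qq = qq⁻¹) (i j : ℕ) :
    (barMap σ (Bq i) * barMap σ (Bq j) = ∑ k ∈ Finset.Icc (max i j) (i + j),
      C (qq ^ ((i : ℤ) * ((i : ℤ) - (k : ℤ)) + (j : ℤ) * ((j : ℤ) - (k : ℤ))) * qFact k /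
          (qFact (k - i) * qFact (k - j) * qFact (i + j - k))) * barMap σ (Bq k)) ∧
    (∀ k ∈ Finset.Icc (max i j) (i + j),
      ∃ g : Polynomial ℕ,
        qq ^ ((i : ℤ) * ((i : ℤ) - (k : ℤ)) + (j : ℤ) * ((j : ℤ) - (k : ℤ))) * qFact k /
            (qFact (k - i) * qFact (k - j) * qFact (i + j - k)) =
          g.eval₂ (Nat.castRingHom K) qq⁻¹) := by
  refine ⟨?_, ?_⟩
  · rw [Finset.sum_congr rfl fun k hk => by rw [sigma_coeff σ hσ i j k hk]]
    rw [← map_mul, Bq_mul, map_sum]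
    have e : Finset.range (j + 1) = Finset.Ico 0 (j + 1) := Finset.range_eq_Ico _
    have h := Finset.sum_Ico_add' (fun k => C (σ (DD i j (k - i))) * barMap σ (Bq k)) 0 (j + 1) i
    rw [e]
    have h2 : ∑ a ∈ Finset.Ico 0 (j + 1), barMap σ (C (DD i j a) * Bq (i + a)) =
        ∑ a ∈ Finset.Ico 0 (j + 1), C (σ (DD i j (a + i - i))) * barMap σ (Bq (a + i)) := by
      refine Finset.sum_congr rfl fun a _ => ?_
      rw [map_mul, barMap_C, Nat.add_sub_cancel, add_comm i a]
    rw [h2, h]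
    symm
    apply Finset.sum_subset
    · intro k hk
      simp only [Finset.mem_Icc, Finset.mem_Ico] at hk ⊢
      omega
    · intro k hk hk'
      simp only [Finset.mem_Icc, Finset.mem_Ico] at hk hk'
      have : DD i j (k - i) = 0 := by
        unfold DD
        rw [gau_lt (i + (k - i)) j (by omega)]
        simp
      rw [this]; simp
  · intro k hk
    rw [sigma_coeff σ hσ i j k hk]
    rw [Finset.mem_Icc] at hk
    refine ⟨X ^ ((k - i) * (k - j)) * (gaussP (i + (k - i)) j * gaussP j (k - i)), ?_⟩
    have e : qq ^ (((k - i : ℕ) : ℤ) * ((i : ℤ) + (k - i : ℕ) - j))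
        = qq ^ ((k - i) * (k - j)) := by
      rw [← zpow_natCast]; congr 1; push_cast
      rw [Nat.cast_sub (by omega : i ≤ k), Nat.cast_sub (by omega : j ≤ k)]; ring
    have hg : ∀ p : Polynomial ℕ, σ (p.eval₂ (Nat.castRingHom K) qq)
        = p.eval₂ (Nat.castRingHom K) qq⁻¹ := by
      intro p
      rw [hom_eval₂, hσ]
      congr 1
      exact Subsingleton.elim _ _
    rw [DD, e, ← hg]
    congr 1
    simp only [gau, eval₂_mul, eval₂_pow, eval₂_X]
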